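/- arXiv:math/0603120 — 4 statements merged into one kernel-verified Lean document; each statement's English description precedes it below -/
import Mathlib

section
/- Let F : ℝ⁴ → Mat₄(ℝ) be the antisymmetric matrix field with entries F(x)₁₂ = 1, F(x)₁₃ = −x₄, F(x)₁₄ = x₃, F(x)₂₃ = x₃, F(x)₂₄ = x₄, F(x)₃₄ = 2(x₁ − (x₃² + x₄²)/2), and F(x)_{kj} = −F(x)_{jk}. Then for every r > 0 and c ∈ ℝ, the helix γ(θ) = (0, c − r²θ, r cos θ, r sin θ) satisfies F(γ(θ))·γ′(θ) = 0 for all θ, and γ′(θ) is tangent to Σ = {x₁ = 0}; i.e. γ is a magnetic line of the Roussarie form (8), winding around Λ = {x₁ = x₃ = x₄ = 0}. -/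
open Matrix

/-- The intensity matrix of the Roussarie canonical 2-form
`σ = dx₁∧dx₂ − x₄ dx₁∧dx₃ + x₃ dx₁∧dx₄ + x₃ dx₂∧dx₃ + x₄ dx₂∧dx₄
   + 2(x₁ − (x₃²+x₄²)/2) dx₃∧dx₄` on `ℝ⁴`. -/
noncomputable def FR (x : Fin 4 → ℝ) : Matrix (Fin 4) (Fin 4) ℝ :=
  !![0, 1, -(x 3), x 2;
     -1, 0, x 2, x 3;
     x 3, -(x 2), 0, 2 * (x 0 - ((x 2) ^ 2 + (x 3) ^ 2) / 2);
     -(x 2), -(x 3), -(2 * (x 0 - ((x 2) ^ 2 + (x 3) ^ 2) / 2)), 0]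

/-- for every `r > 0` and `c ∈ ℝ` the helix
`γ(θ) = (0, c − r²θ, r cos θ, r sin θ)` is a magnetic line of the Roussarie form:
its velocity lies in `ker F(γ(θ))` and is tangent to `Σ = {x₁ = 0}`. -/
theorem stmt_4 (r c : ℝ) (hr : 0 < r)
    (γ : ℝ → Fin 4 → ℝ)
    (hγ : γ = fun θ => ![0, c - r ^ 2 * θ, r * Real.cos θ, r * Real.sin θ])
    (d : ℝ → Fin 4 → ℝ)
    (hd : d = fun θ => ![0, -(r ^ 2), -(r * Real.sin θ), r * Real.cos θ]) :
    (∀ θ, HasDerivAt γ (d θ) θ) ∧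
    (∀ θ, FR (γ θ) *ᵥ d θ = 0) ∧
    (∀ θ, d θ 0 = 0) := by
  subst hγ hd
  refine ⟨fun θ => hasDerivAt_pi.2 fun i => ?_, fun θ => ?_, fun θ => rfl⟩
  · fin_cases i
    · exact hasDerivAt_const θ (0 : ℝ)
    · simpa using ((hasDerivAt_id θ).const_mul (r ^ 2)).const_sub c
    · simpa using (Real.hasDerivAt_cos θ).const_mul r
    · simpa using (Real.hasDerivAt_sin θ).const_mul r
  · have h := Real.sin_sq_add_cos_sq θ
    ext i
    fin_cases i <;> simp [FR, Matrix.mulVec, dotProduct, Fin.sum_univ_four]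
    · linear_combination r ^ 2 * h
    · ring
    · linear_combination -(r ^ 3 * Real.cos θ) * h
    · linear_combination -(r ^ 3 * Real.sin θ) * h
end

section
/- Let ν ≥ 2 be even, k = 0, 𝒱(x₁; 0) = 1 − x₁^{2ν}/ν², and x* = ν^{1/ν} (so 𝒱(±x*; 0) = 0 and 𝒱 > 0 on (−x*, x*)). Then the increment of x₂ over one period, I(0) = 2∫_{−x*}^{x*} (0 − x₁^ν/ν)/√(2𝒱(x₁; 0)) dx₁, converges as an improper integral and is strictly negative. Hence for even ν the zero-drift value k* of k satisfies k* ≠ 0 (the drift at k = 0 is downward). -/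
open MeasureTheory

theorem intervalIntegrable_inv_sqrt_one_sub_div_sq {a : ℝ} (ha : 0 < a) :
    IntervalIntegrable (fun x : ℝ => (√(1 - (x / a) ^ 2))⁻¹) volume (-a) a := by
  rw [intervalIntegrable_iff_integrableOn_Ioc_of_le (by linarith)]
  refine intervalIntegral.integrableOn_deriv_of_nonneg
    (g := fun x => Real.arcsin (x / a) * a) ?_ ?_ ?_
  · exact ((Real.continuous_arcsin.comp (continuous_id.div_const a)).mul
      continuous_const).continuousOn
  · rintro x ⟨h₁, h₂⟩
    have hl : x / a ≠ -1 := by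
      rw [Ne, div_eq_iff ha.ne']; linarith
    have hr : x / a ≠ 1 := by
      rw [Ne, div_eq_iff ha.ne']; linarith
    have h := ((Real.hasDerivAt_arcsin hl hr).comp x ((hasDerivAt_id x).div_const a)).mul_const a
    refine h.congr_deriv ?_
    rw [mul_assoc, one_div_mul_cancel ha.ne', mul_one, one_div]
  · intro x _
    positivity

/-- Between its zeros `±a`, the potential `1 - x ^ (2 * n) / c ^ 2` dominates `1 - (x / a) ^ 2 > 0`. -/
theorem one_sub_div_sq_le_one_sub_pow {n : ℕ} (hn : 1 ≤ n) {a c x : ℝ} (ha : 0 < a)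
    (hac : a ^ n = c) (hx : x ∈ Set.Ioo (-a) a) :
    0 < 1 - (x / a) ^ 2 ∧ 1 - (x / a) ^ 2 ≤ 1 - x ^ (2 * n) / c ^ 2 := by
  have habs : |x / a| < 1 := by
    rw [abs_div, abs_of_pos ha, div_lt_one ha]
    exact abs_lt.mpr hx
  have hsq : (x / a) ^ 2 < 1 := (sq_lt_one_iff_abs_lt_one _).mpr habs
  have heq : x ^ (2 * n) / c ^ 2 = ((x / a) ^ 2) ^ n := by
    rw [← hac, ← pow_mul, ← pow_mul, div_pow, mul_comm n 2]
  refine ⟨by linarith, ?_⟩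
  rw [heq]
  have := pow_le_of_le_one (sq_nonneg (x / a)) hsq.le (by omega : n ≠ 0)
  linarith

/-- for even `ν ≥ 2`, `k = 0`, `𝒱(x₁;0) = 1 − x₁^{2ν}/ν²` and
`x* = ν^{1/ν}` (so `𝒱(±x*;0) = 0` and `𝒱 > 0` on `(−x*,x*)`), the increment of
`x₂` over one period
`I(0) = 2∫_{−x*}^{x*} (0 − x₁^ν/ν)/√(2𝒱(x₁;0)) dx₁`
converges and is strictly negative: for even `ν` the drift at `k = 0` is
downward, so the zero-drift value `k*` is nonzero. -/
theorem stmt_14 (ν : ℕ) (hν : 2 ≤ ν) (heven : Even ν) (xstar : ℝ)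
    (hx : xstar = (ν : ℝ) ^ ((ν : ℝ)⁻¹)) :
    (1 - xstar ^ (2 * ν) / (ν : ℝ) ^ 2 = 0) ∧
    (1 - (-xstar) ^ (2 * ν) / (ν : ℝ) ^ 2 = 0) ∧
    (∀ x ∈ Set.Ioo (-xstar) xstar, 0 < 1 - x ^ (2 * ν) / (ν : ℝ) ^ 2) ∧
    IntervalIntegrable
      (fun x : ℝ => (0 - x ^ ν / (ν : ℝ)) / Real.sqrt (2 * (1 - x ^ (2 * ν) / (ν : ℝ) ^ 2)))
      volume (-xstar) xstar ∧
    2 * ∫ x in (-xstar)..xstar,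
        (0 - x ^ ν / (ν : ℝ)) / Real.sqrt (2 * (1 - x ^ (2 * ν) / (ν : ℝ) ^ 2)) < 0 := by
  have hν0 : (0 : ℝ) < ν := by
    have : 0 < ν := by omega
    exact_mod_cast this
  have ha : 0 < xstar := hx ▸ Real.rpow_pos_of_pos hν0 _
  have haν : xstar ^ ν = ν := by
    rw [hx]
    exact Real.rpow_inv_natCast_pow hν0.le (by omega)
  have hzero : 1 - xstar ^ (2 * ν) / (ν : ℝ) ^ 2 = 0 := by
    rw [mul_comm, pow_mul, haν, div_self (by positivity), sub_self]
  have hbound := fun x hxI => one_sub_div_sq_le_one_sub_pow (by omega : 1 ≤ ν) (x := x) ha haν hxI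
  have hV : ∀ x ∈ Set.Ioo (-xstar) xstar, 0 < 1 - x ^ (2 * ν) / (ν : ℝ) ^ 2 :=
    fun x hxI => (hbound x hxI).1.trans_le (hbound x hxI).2
  set f : ℝ → ℝ := fun x =>
    (0 - x ^ ν / (ν : ℝ)) / Real.sqrt (2 * (1 - x ^ (2 * ν) / (ν : ℝ) ^ 2)) with hf
  have hint : IntervalIntegrable f volume (-xstar) xstar := by
    have hg := intervalIntegrable_inv_sqrt_one_sub_div_sq ha
    rw [intervalIntegrable_iff_integrableOn_Ioo_of_le (by linarith)] at hg ⊢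
    refine Integrable.mono' hg (by fun_prop) ?_
    filter_upwards [ae_restrict_mem measurableSet_Ioo] with x hxI
    obtain ⟨hpos, hle⟩ := hbound x hxI
    have hnum : ‖0 - x ^ ν / (ν : ℝ)‖ ≤ 1 := by
      rw [zero_sub, norm_neg, norm_div, norm_pow, Real.norm_eq_abs, Real.norm_of_nonneg hν0.le,
        div_le_one hν0]
      calc |x| ^ ν ≤ xstar ^ ν := by
            gcongr
            exact (abs_lt.mpr hxI).le
        _ = ν := haν
    rw [hf, norm_div, Real.norm_of_nonneg (Real.sqrt_nonneg _), ← one_div]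
    exact div_le_div₀ zero_le_one hnum (Real.sqrt_pos.mpr hpos) (Real.sqrt_le_sqrt (by linarith))
  have hneg : ∀ x ∈ Set.Ioo (-xstar) xstar, x ≠ 0 → 0 < -f x := by
    intro x hxI hx0
    have hVx := hV x hxI
    have hpow := heven.pow_pos hx0
    rw [hf, ← neg_div, zero_sub, neg_neg]
    positivity
  have hleft : IntervalIntegrable f volume (-xstar) 0 :=
    hint.mono_set (Set.uIcc_subset_uIcc_left (Set.mem_uIcc.mpr (Or.inl ⟨by linarith, ha.le⟩)))
  have hright : IntervalIntegrable f volume 0 xstar :=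
    hint.mono_set (Set.uIcc_subset_uIcc_right (Set.mem_uIcc.mpr (Or.inl ⟨by linarith, ha.le⟩)))
  have hIleft : 0 < ∫ x in (-xstar)..0, -f x :=
    intervalIntegral.intervalIntegral_pos_of_pos_on hleft.neg
      (fun x hxI => hneg x ⟨hxI.1, hxI.2.trans ha⟩ hxI.2.ne) (by linarith)
  have hIright : 0 < ∫ x in (0)..xstar, -f x :=
    intervalIntegral.intervalIntegral_pos_of_pos_on hright.neg
      (fun x hxI => hneg x ⟨by linarith [hxI.1], hxI.2⟩ hxI.1.ne') ha
  refine ⟨hzero, ?_, hV, hint, ?_⟩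
  · rwa [(even_two_mul ν).neg_pow]
  · rw [intervalIntegral.integral_neg] at hIleft hIright
    rw [← intervalIntegral.integral_add_adjacent_intervals hleft hright]
    linarith
end

section
/- Fix μ > 0 and consider on the phase space with coordinates (x₁, x₂, ρ, θ; ξ₁, ξ₂, ϱ, ϑ), ρ > 0, the Hamiltonian 2H = ξ₁² + (ξ₂ − μ(x₁ − ρ²/2))² + ϱ² + ρ^{-2}(ϑ − μ(x₁ − ρ²/4)ρ²)² − 1. Along any solution of Hamilton's equations: (i) ξ₂(t) and ϑ(t) are constant (H does not depend on x₂ or θ); (ii) if E denotes the (conserved) value of H and 2E + 1 ≥ 0, then |x₁(t) − ρ(t)²/2 − ξ₂/μ| ≤ √(2E+1)/μ for all t, and hence |(x₁(t) − ρ(t)²/2) − (x₁(s) − ρ(s)²/2)| ≤ 2√(2E+1)/μ for all t, s; i.e. the quantity x₁ − ρ²/2 is preserved modulo O(μ^{-1}). -/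
/-- A real function whose derivative vanishes everywhere takes its value at `0` everywhere. -/
lemma eq_zero_value_of_hasDerivAt_zero {f : ℝ → ℝ} (hf : ∀ t, HasDerivAt f 0 t) (t : ℝ) :
    f t = f 0 :=
  is_const_of_deriv_eq_zero (fun u => (hf u).differentiableAt) (fun u => (hf u).deriv) t 0

/-- for the Hamiltonian (23) associated to the Roussarie form,
`2H = ξ₁² + (ξ₂ − μ(x₁ − ρ²/2))² + ϱ² + ρ⁻²(ϑ − μ(x₁ − ρ²/4)ρ²)² − 1`
(in coordinates `(x₁,x₂,ρ,θ)` with dual momenta `(ξ₁,ξ₂,ϱ,ϑ)`, `ρ > 0`),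
along any solution of Hamilton's equations: (i) `ξ₂` and `ϑ` are constant;
(ii) `H` is conserved, and if `2E + 1 ≥ 0` for its value `E`, then
`|x₁ − ρ²/2 − ξ₂/μ| ≤ √(2E+1)/μ`, hence `x₁ − ρ²/2` is preserved
modulo `O(μ⁻¹)`. -/
theorem stmt_15 (μ : ℝ) (hμ : 0 < μ)
    (x1 x2 ρ θ ξ1 ξ2 ϱ ϑ : ℝ → ℝ) (E : ℝ)
    (hρpos : ∀ t, 0 < ρ t)
    -- Hamilton's equations  q̇ = ∂_p H, ṗ = −∂_q H :
    (hx1 : ∀ t, HasDerivAt x1 (ξ1 t) t)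
    (hx2 : ∀ t, HasDerivAt x2 (ξ2 t - μ * (x1 t - (ρ t) ^ 2 / 2)) t)
    (hρ : ∀ t, HasDerivAt ρ (ϱ t) t)
    (hθ : ∀ t, HasDerivAt θ
      ((ϑ t - μ * (x1 t - (ρ t) ^ 2 / 4) * (ρ t) ^ 2) / (ρ t) ^ 2) t)
    (hξ1 : ∀ t, HasDerivAt ξ1
      (μ * (ξ2 t - μ * (x1 t - (ρ t) ^ 2 / 2)) +
       μ * (ϑ t - μ * (x1 t - (ρ t) ^ 2 / 4) * (ρ t) ^ 2)) t)
    (hξ2 : ∀ t, HasDerivAt ξ2 0 t)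
    (hϱ : ∀ t, HasDerivAt ϱ
      (-(μ * ρ t * (ξ2 t - μ * (x1 t - (ρ t) ^ 2 / 2))) +
       μ * (ϑ t - μ * (x1 t - (ρ t) ^ 2 / 4) * (ρ t) ^ 2) *
         (2 * x1 t * ρ t - (ρ t) ^ 3) / (ρ t) ^ 2 +
       (ϑ t - μ * (x1 t - (ρ t) ^ 2 / 4) * (ρ t) ^ 2) ^ 2 / (ρ t) ^ 3) t)
    (hϑ : ∀ t, HasDerivAt ϑ 0 t)
    -- E is the value of H at time 0, and 2E + 1 ≥ 0 :
    (hE : E = (1 / 2) * ((ξ1 0) ^ 2 + (ξ2 0 - μ * (x1 0 - (ρ 0) ^ 2 / 2)) ^ 2 +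
      (ϱ 0) ^ 2 + (ϑ 0 - μ * (x1 0 - (ρ 0) ^ 2 / 4) * (ρ 0) ^ 2) ^ 2 / (ρ 0) ^ 2 - 1))
    (h2E : 0 ≤ 2 * E + 1) :
    -- (i) ξ₂ and ϑ are constant:
    (∀ t, ξ2 t = ξ2 0) ∧ (∀ t, ϑ t = ϑ 0) ∧
    -- H is conserved with value E:
    (∀ t, (1 / 2) * ((ξ1 t) ^ 2 + (ξ2 t - μ * (x1 t - (ρ t) ^ 2 / 2)) ^ 2 +
      (ϱ t) ^ 2 + (ϑ t - μ * (x1 t - (ρ t) ^ 2 / 4) * (ρ t) ^ 2) ^ 2 / (ρ t) ^ 2 - 1)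
        = E) ∧
    -- (ii) x₁ − ρ²/2 is preserved modulo O(μ⁻¹):
    (∀ t, |x1 t - (ρ t) ^ 2 / 2 - ξ2 0 / μ| ≤ Real.sqrt (2 * E + 1) / μ) ∧
    (∀ t s, |(x1 t - (ρ t) ^ 2 / 2) - (x1 s - (ρ s) ^ 2 / 2)| ≤
      2 * Real.sqrt (2 * E + 1) / μ) := by
  have hξ2c := eq_zero_value_of_hasDerivAt_zero hξ2
  have hH : ∀ t, (1 / 2) * ((ξ1 t) ^ 2 + (ξ2 t - μ * (x1 t - (ρ t) ^ 2 / 2)) ^ 2 +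
      (ϱ t) ^ 2 + (ϑ t - μ * (x1 t - (ρ t) ^ 2 / 4) * (ρ t) ^ 2) ^ 2 / (ρ t) ^ 2 - 1)
        = E := by
    intro t
    rw [hE]
    refine eq_zero_value_of_hasDerivAt_zero (f := fun t => (1 / 2) * ((ξ1 t) ^ 2 +
      (ξ2 t - μ * (x1 t - (ρ t) ^ 2 / 2)) ^ 2 + (ϱ t) ^ 2 +
      (ϑ t - μ * (x1 t - (ρ t) ^ 2 / 4) * (ρ t) ^ 2) ^ 2 / (ρ t) ^ 2 - 1)) (fun u => ?_) t
    have hne : ρ u ≠ 0 := (hρpos u).ne'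
    have hA := (hξ2 u).fun_sub (((hx1 u).fun_sub (((hρ u).fun_pow 2).div_const 2)).const_mul μ)
    have hB := (hϑ u).fun_sub ((((hx1 u).fun_sub (((hρ u).fun_pow 2).div_const 4)).const_mul
      μ).fun_mul ((hρ u).fun_pow 2))
    have hsum := ((((((hξ1 u).fun_pow 2).fun_add (hA.fun_pow 2)).fun_add
      ((hϱ u).fun_pow 2)).fun_add ((hB.fun_pow 2).fun_div ((hρ u).fun_pow 2)
        (pow_ne_zero 2 hne))).sub_const 1).const_mul (1 / 2)
    refine hsum.congr_deriv ?_
    field_simp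
    ring
  have hbound : ∀ t, |x1 t - (ρ t) ^ 2 / 2 - ξ2 0 / μ| ≤ Real.sqrt (2 * E + 1) / μ := by
    intro t
    have hsq : (ξ2 t - μ * (x1 t - (ρ t) ^ 2 / 2)) ^ 2 ≤ 2 * E + 1 := by
      have hnonneg : 0 ≤ (ϑ t - μ * (x1 t - (ρ t) ^ 2 / 4) * (ρ t) ^ 2) ^ 2 / (ρ t) ^ 2 := by
        positivity
      linarith [hH t, sq_nonneg (ξ1 t), sq_nonneg (ϱ t)]
    have heq : x1 t - (ρ t) ^ 2 / 2 - ξ2 0 / μ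
        = -(ξ2 t - μ * (x1 t - (ρ t) ^ 2 / 2)) / μ := by
      rw [hξ2c t]
      field_simp
      ring
    rw [heq, abs_div, abs_neg, abs_of_pos hμ]
    gcongr
    exact Real.abs_le_sqrt hsq
  refine ⟨hξ2c, eq_zero_value_of_hasDerivAt_zero hϑ, hH, hbound, fun t s => ?_⟩
  calc |(x1 t - (ρ t) ^ 2 / 2) - (x1 s - (ρ s) ^ 2 / 2)|
      = |(x1 t - (ρ t) ^ 2 / 2 - ξ2 0 / μ) - (x1 s - (ρ s) ^ 2 / 2 - ξ2 0 / μ)| := by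
        rw [sub_sub_sub_cancel_right]
    _ ≤ |x1 t - (ρ t) ^ 2 / 2 - ξ2 0 / μ| + |x1 s - (ρ s) ^ 2 / 2 - ξ2 0 / μ| := abs_sub _ _
    _ ≤ Real.sqrt (2 * E + 1) / μ + Real.sqrt (2 * E + 1) / μ := add_le_add (hbound t) (hbound s)
    _ = 2 * Real.sqrt (2 * E + 1) / μ := by ring
end

section
/- For y ∈ ℝ let s(y) = y − ⌊y + 1/2⌋ (the periodized sawtooth, taking values in [−1/2, 1/2)). Then for every t ∈ ℝ the improper integral G(t) = lim_{R→∞} ∫_{−R}^{R} s(t + η²/2) dη exists and is finite. -/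
open Filter

/-- The periodized sawtooth `s(y) = y − ⌊y + 1/2⌋`, taking values in `[−1/2, 1/2)`. -/
noncomputable def saw (y : ℝ) : ℝ := y - ⌊y + 1 / 2⌋

open MeasureTheory Set Topology

theorem saw_eq_fract (y : ℝ) : saw y = Int.fract (y + 1 / 2) - 1 / 2 := by
  rw [saw, Int.fract]; ring

theorem abs_saw_le (y : ℝ) : |saw y| ≤ 1 / 2 := by
  rw [saw_eq_fract, abs_le]
  constructor <;> linarith [Int.fract_nonneg (y + 1 / 2), Int.fract_lt_one (y + 1 / 2)]

theorem measurable_saw : Measurable saw := by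
  have : saw = fun y => Int.fract (y + 1 / 2) - 1 / 2 := funext saw_eq_fract
  rw [this]
  exact (measurable_fract.comp (measurable_id.add_const _)).sub_const _

theorem continuous_saw_sq : Continuous fun y => saw y ^ 2 := by
  have hfract : Continuous ((fun x : ℝ => (x - 1 / 2) ^ 2) ∘ Int.fract) :=
    ContinuousOn.comp_fract'' (Continuous.continuousOn (by fun_prop)) (by norm_num)
  have : (fun y => saw y ^ 2) =
      fun y => ((fun x : ℝ => (x - 1 / 2) ^ 2) ∘ Int.fract) (y + 1 / 2) :=
    funext fun y => by simp [saw_eq_fract]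
  rw [this]
  exact hfract.comp (by fun_prop)

theorem saw_eventuallyEq_nhdsGE (y : ℝ) :
    ∀ᶠ z in 𝓝[≥] y, saw z = z - ⌊y + 1 / 2⌋ := by
  have hshift : Tendsto (fun z : ℝ => z + 1 / 2) (𝓝[≥] y) (𝓝[≥] (y + 1 / 2)) := by
    refine tendsto_nhdsWithin_of_tendsto_nhds_of_eventually_within _ ?_ ?_
    · exact ((continuous_id.add continuous_const).tendsto y).mono_left nhdsWithin_le_nhds
    · filter_upwards [self_mem_nhdsWithin] with z hz
      simpa using hz
  have hfloor := (tendsto_floor_right_pure_floor (y + 1 / 2)).comp hshift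
  filter_upwards [tendsto_pure.1 hfloor] with z hz
  simp only [Function.comp_apply] at hz
  rw [saw, hz]

theorem intervalIntegrable_saw_quadratic (t a b : ℝ) :
    IntervalIntegrable (fun η => saw (t + η ^ 2 / 2)) volume a b := by
  refine (intervalIntegrable_const (c := (1 / 2 : ℝ))).mono_fun
    (measurable_saw.comp (by fun_prop)).aestronglyMeasurable (ae_of_all _ fun η => ?_)
  simpa using abs_saw_le (t + η ^ 2 / 2)

theorem hasDerivWithinAt_saw_sq_div (t : ℝ) {x : ℝ} (hx : 0 < x) :
    HasDerivWithinAt (fun η => saw (t + η ^ 2 / 2) ^ 2 / 2 / η)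
      (saw (t + x ^ 2 / 2) - saw (t + x ^ 2 / 2) ^ 2 / 2 / x ^ 2) (Ioi x) x := by
  set c : ℝ := (⌊t + x ^ 2 / 2 + 1 / 2⌋ : ℝ) with hc
  have hquad : Tendsto (fun η : ℝ => t + η ^ 2 / 2) (𝓝[>] x) (𝓝[≥] (t + x ^ 2 / 2)) := by
    refine tendsto_nhdsWithin_of_tendsto_nhds_of_eventually_within _ ?_ ?_
    · exact (Continuous.tendsto (by fun_prop) x).mono_left nhdsWithin_le_nhds
    · filter_upwards [self_mem_nhdsWithin] with z hz
      have hz : x < z := hz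
      simp only [mem_Ici]
      nlinarith
  have heq : (fun η => saw (t + η ^ 2 / 2) ^ 2 / 2 / η) =ᶠ[𝓝[>] x]
      fun η => (t + η ^ 2 / 2 - c) ^ 2 / 2 / η := by
    filter_upwards [hquad.eventually (saw_eventuallyEq_nhdsGE (t + x ^ 2 / 2))] with z hz
    rw [hz]
  have hbase : HasDerivAt (fun η : ℝ => t + η ^ 2 / 2 - c) x x := by
    have := (((hasDerivAt_pow 2 x).div_const 2).const_add t).sub_const c
    exact this.congr_deriv (by norm_num)
  have hderiv := ((hbase.pow 2).div_const 2).div (hasDerivAt_id x) hx.ne'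
  refine HasDerivWithinAt.congr_of_eventuallyEq ?_ heq (by simp only [saw, hc])
  refine hderiv.hasDerivWithinAt.congr_deriv ?_
  have hsaw : saw (t + x ^ 2 / 2) = t + x ^ 2 / 2 - c := rfl
  rw [hsaw]
  simp only [Pi.pow_apply, id]
  field_simp
  norm_num
  ring

theorem continuousOn_saw_sq_div (t : ℝ) {n : ℕ} :
    ContinuousOn (fun η => saw (t + η ^ 2 / 2) ^ 2 / 2 / η ^ n) (Ioi 0) := by
  have hcont : Continuous fun η : ℝ => saw (t + η ^ 2 / 2) ^ 2 :=
    continuous_saw_sq.comp (f := fun η : ℝ => t + η ^ 2 / 2) (by fun_prop)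
  exact (hcont.div_const 2).continuousOn.div (by fun_prop) fun x hx => pow_ne_zero _ (ne_of_gt hx)

theorem saw_sq_half_le (y : ℝ) : saw y ^ 2 / 2 ≤ 1 := by
  have := abs_le.1 (abs_saw_le y)
  nlinarith

theorem integrableOn_saw_sq_div_sq (t : ℝ) :
    IntegrableOn (fun η => saw (t + η ^ 2 / 2) ^ 2 / 2 / η ^ 2) (Ioi 1) := by
  have hdom : IntegrableOn (fun η : ℝ => η ^ (-2 : ℝ)) (Ioi 1) :=
    integrableOn_Ioi_rpow_of_lt (by norm_num) one_pos
  refine Integrable.mono' hdom (((continuousOn_saw_sq_div t).mono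
    (Ioi_subset_Ioi zero_le_one)).aestronglyMeasurable measurableSet_Ioi) ?_
  filter_upwards [ae_restrict_mem measurableSet_Ioi] with η hη
  have hη0 : 0 < η := one_pos.trans hη
  rw [Real.norm_of_nonneg (by positivity), Real.rpow_neg hη0.le, Real.rpow_two, ← one_div]
  gcongr
  exact saw_sq_half_le _

theorem integral_saw_quadratic_eq (t : ℝ) {R : ℝ} (hR : 1 ≤ R) :
    ∫ η in (1 : ℝ)..R, saw (t + η ^ 2 / 2) =
      saw (t + R ^ 2 / 2) ^ 2 / 2 / R - saw (t + 1 ^ 2 / 2) ^ 2 / 2 / 1 +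
        ∫ η in (1 : ℝ)..R, saw (t + η ^ 2 / 2) ^ 2 / 2 / η ^ 2 := by
  have hpos : uIcc 1 R ⊆ Ioi (0 : ℝ) := fun x hx => by
    rw [uIcc_of_le hR] at hx
    exact one_pos.trans_le hx.1
  have hint : IntervalIntegrable (fun η => saw (t + η ^ 2 / 2) ^ 2 / 2 / η ^ 2) volume 1 R :=
    ((continuousOn_saw_sq_div t).mono hpos).intervalIntegrable
  have hsaw := intervalIntegrable_saw_quadratic t 1 R
  have hftc := intervalIntegral.integral_eq_sub_of_hasDeriv_right
    (f := fun η => saw (t + η ^ 2 / 2) ^ 2 / 2 / η)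
    (by simpa using (continuousOn_saw_sq_div t (n := 1)).mono hpos)
    (fun x hx => hasDerivWithinAt_saw_sq_div t
      (one_pos.trans (by simpa [hR] using hx.1))) (hsaw.sub hint)
  rw [intervalIntegral.integral_sub hsaw hint] at hftc
  linarith

theorem tendsto_saw_sq_div_atTop (t : ℝ) :
    Tendsto (fun R => saw (t + R ^ 2 / 2) ^ 2 / 2 / R) atTop (𝓝 0) := by
  refine squeeze_zero' ?_ ?_ tendsto_inv_atTop_zero
  · filter_upwards [eventually_gt_atTop 0] with R hR
    positivity
  · filter_upwards [eventually_gt_atTop 0] with R hR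
    rw [← one_div]
    gcongr
    exact saw_sq_half_le _

theorem integral_saw_quadratic_symm (t R : ℝ) :
    ∫ η in (-R)..R, saw (t + η ^ 2 / 2) =
      2 * ((∫ η in (0 : ℝ)..1, saw (t + η ^ 2 / 2)) +
        ∫ η in (1 : ℝ)..R, saw (t + η ^ 2 / 2)) := by
  have hint := intervalIntegrable_saw_quadratic t
  have hneg : ∫ η in (-R)..0, saw (t + η ^ 2 / 2) = ∫ η in (0 : ℝ)..R, saw (t + η ^ 2 / 2) := by
    rw [← neg_zero, ← intervalIntegral.integral_comp_neg, neg_zero]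
    exact intervalIntegral.integral_congr fun η _ => by simp only [neg_sq]
  rw [intervalIntegral.integral_add_adjacent_intervals (hint 0 1) (hint 1 R),
    ← intervalIntegral.integral_add_adjacent_intervals (hint (-R) 0) (hint 0 R), hneg]
  ring

/-- for every `t ∈ ℝ` the improper integral
`G(t) = lim_{R→∞} ∫_{−R}^{R} s(t + η²/2) dη` exists and is finite. -/
theorem stmt_16 :
    ∀ t : ℝ, ∃ L : ℝ,
      Tendsto (fun R : ℝ => ∫ η in (-R)..R, saw (t + η ^ 2 / 2)) atTop (nhds L) := by
  intro t
  have hlim := (((tendsto_saw_sq_div_atTop t).sub_const (saw (t + 1 ^ 2 / 2) ^ 2 / 2 / 1)).add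
    (intervalIntegral_tendsto_integral_Ioi 1 (integrableOn_saw_sq_div_sq t) tendsto_id)).const_add
      (∫ η in (0 : ℝ)..1, saw (t + η ^ 2 / 2)) |>.const_mul 2
  refine ⟨_, hlim.congr' ?_⟩
  filter_upwards [eventually_ge_atTop 1] with R hR
  rw [integral_saw_quadratic_symm, integral_saw_quadratic_eq t hR, id]
end
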